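/- arXiv:1805.12019 — 4 statements merged into one kernel-verified Lean document; each statement's English description precedes it below -/
import Mathlib

section
/- Let (V, Φ) be a finite-dimensional ℚ-vector space with a nondegenerate symmetric bilinear form and L ⊆ V a full even unimodular lattice. Fix an integer n ≥ 2 and form V' = V × ℚ with the symmetric bilinear form Φ'((v,a),(w,b)) = Φ(v,w) − (2n−2)·a·b and the full lattice M = L × ℤ. If D ∈ M is primitive and has divisibility 2 in the weak sense that Φ'(D, y) ∈ 2ℤ for every y ∈ M, then Φ'(D, D) ≡ 2 − 2n (mod 8). -/
/-- **Squares of divisibility-2 classes in `Λ_n = L ⊕ ⟨-(2n-2)⟩` are `≡ 2-2n (mod 8)`.**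
Let `(V, Φ)` be a finite-dimensional `ℚ`-vector space with a nondegenerate symmetric
bilinear form and `L ⊆ V` a full even unimodular lattice.  Fix `n ≥ 2`, let
`Φ'((v,a),(w,b)) = Φ(v,w) - (2n-2)·a·b` on `V × ℚ` and `M = L × ℤ`.  If `D ∈ M` is
primitive and `Φ'(D, y) ∈ 2ℤ` for every `y ∈ M`, then `Φ'(D,D) ≡ 2 - 2n (mod 8)`. -/
theorem square_of_divisibility_two_class
    {V : Type*} [AddCommGroup V] [Module ℚ V] [FiniteDimensional ℚ V]
    (Φ : V →ₗ[ℚ] V →ₗ[ℚ] ℚ)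
    (hsymm : ∀ x y : V, Φ x y = Φ y x)
    (hnd : ∀ v : V, (∀ w : V, Φ v w = 0) → v = 0)
    (L : Submodule ℤ V) (hfg : L.FG)
    (hfull : Submodule.span ℚ (L : Set V) = ⊤)
    (hint : ∀ x ∈ L, ∀ y ∈ L, ∃ k : ℤ, Φ x y = (k : ℚ))
    (heven : ∀ x ∈ L, ∃ k : ℤ, Φ x x = ((2 * k : ℤ) : ℚ))
    (huni : ∀ v : V, (∀ x ∈ L, ∃ k : ℤ, Φ v x = (k : ℚ)) ↔ v ∈ L)
    (n : ℤ) (hn : 2 ≤ n)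
    (Φ' : (V × ℚ) →ₗ[ℚ] (V × ℚ) →ₗ[ℚ] ℚ)
    (hΦ' : ∀ p q : V × ℚ, Φ' p q = Φ p.1 q.1 - ((2 * n - 2 : ℤ) : ℚ) * p.2 * q.2)
    (M : Submodule ℤ (V × ℚ))
    (hM : ∀ p : V × ℚ, p ∈ M ↔ p.1 ∈ L ∧ ∃ k : ℤ, p.2 = (k : ℚ))
    (D : V × ℚ) (hD : D ∈ M)
    (hprim : ∀ (k : ℤ) (u : V × ℚ), u ∈ M → D = k • u → k = 1 ∨ k = -1)
    (hdiv : ∀ y ∈ M, ∃ k : ℤ, Φ' D y = ((2 * k : ℤ) : ℚ)) :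
    ∃ k : ℤ, Φ' D D = ((2 - 2 * n + 8 * k : ℤ) : ℚ) := by
  obtain ⟨v, a⟩ := D
  obtain ⟨hv, m, rfl⟩ : v ∈ L ∧ ∃ k : ℤ, a = (k : ℚ) := (hM _).1 hD
  have hhalf : (2⁻¹ : ℚ) • v ∈ L := by
    refine (huni _).1 fun x hx => ?_
    obtain ⟨k, hk⟩ := hdiv (x, 0) ((hM _).2 ⟨hx, 0, by simp⟩)
    refine ⟨k, ?_⟩
    simp only [hΦ', mul_zero, sub_zero] at hk
    simp [hk]
  obtain ⟨u, hu, rfl⟩ : ∃ u ∈ L, v = (2 : ℤ) • u :=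
    ⟨_, hhalf, by rw [two_smul, ← add_smul]; norm_num⟩
  obtain ⟨b, rfl⟩ : Odd m := by
    by_contra hodd
    obtain ⟨b, rfl⟩ := Int.not_odd_iff_even.1 hodd
    have := hprim 2 (u, (b : ℚ)) ((hM _).2 ⟨hu, b, rfl⟩)
      (Prod.ext rfl (by simp [two_mul]))
    omega
  obtain ⟨k, hk⟩ := heven u hu
  refine ⟨k - (n - 1) * (b ^ 2 + b), ?_⟩
  rw [hΦ']
  simp only [two_smul, map_add, LinearMap.add_apply, hk]
  push_cast
  ring
end

section
/- Let (V, Φ) be a finite-dimensional ℚ-vector space with a nondegenerate symmetric bilinear form and L ⊆ V a full even unimodular lattice containing a hyperbolic pair, i.e. elements e, f ∈ L with Φ(e,e) = Φ(f,f) = 0 and Φ(e,f) = 1. Fix an integer n ≥ 2 and form V' = V × ℚ with the symmetric bilinear form Φ'((v,a),(w,b)) = Φ(v,w) − (2n−2)·a·b and the full lattice M = L × ℤ. Then for every integer d there exists a primitive element D ∈ M of divisibility exactly 2 (that is, Φ'(D,y) ∈ 2ℤ for all y ∈ M, and Φ'(D, y₀) = 2 for some y₀ ∈ M) with Φ'(D,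 D) = 8d − (2n−2). (One may take D = (2(e + d·f), 1).) -/
/-- **Every value `8d - (2n-2)` is the square of a primitive divisibility-2 class.**
Let `(V, Φ)` be a finite-dimensional `ℚ`-vector space with a nondegenerate symmetric
bilinear form and `L ⊆ V` a full even unimodular lattice containing a hyperbolic pair
`e, f` (`Φ(e,e) = Φ(f,f) = 0`, `Φ(e,f) = 1`).  Fix `n ≥ 2`, let
`Φ'((v,a),(w,b)) = Φ(v,w) - (2n-2)·a·b` on `V × ℚ` and `M = L × ℤ`.  Then for every
integer `d` there is a primitive `D ∈ M` of divisibility exactly `2`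
(`Φ'(D,y) ∈ 2ℤ` for all `y ∈ M` and `Φ'(D,y₀) = 2` for some `y₀ ∈ M`) with
`Φ'(D,D) = 8d - (2n-2)`. -/
theorem exists_primitive_divisibility_two_class
    {V : Type*} [AddCommGroup V] [Module ℚ V] [FiniteDimensional ℚ V]
    (Φ : V →ₗ[ℚ] V →ₗ[ℚ] ℚ)
    (hsymm : ∀ x y : V, Φ x y = Φ y x)
    (hnd : ∀ v : V, (∀ w : V, Φ v w = 0) → v = 0)
    (L : Submodule ℤ V) (hfg : L.FG)
    (hfull : Submodule.span ℚ (L : Set V) = ⊤)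
    (hint : ∀ x ∈ L, ∀ y ∈ L, ∃ k : ℤ, Φ x y = (k : ℚ))
    (heven : ∀ x ∈ L, ∃ k : ℤ, Φ x x = ((2 * k : ℤ) : ℚ))
    (huni : ∀ v : V, (∀ x ∈ L, ∃ k : ℤ, Φ v x = (k : ℚ)) ↔ v ∈ L)
    (e f : V) (he : e ∈ L) (hf : f ∈ L)
    (hee : Φ e e = 0) (hff : Φ f f = 0) (hef : Φ e f = 1)
    (n : ℤ) (hn : 2 ≤ n)
    (Φ' : (V × ℚ) →ₗ[ℚ] (V × ℚ) →ₗ[ℚ] ℚ)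
    (hΦ' : ∀ p q : V × ℚ, Φ' p q = Φ p.1 q.1 - ((2 * n - 2 : ℤ) : ℚ) * p.2 * q.2)
    (M : Submodule ℤ (V × ℚ))
    (hM : ∀ p : V × ℚ, p ∈ M ↔ p.1 ∈ L ∧ ∃ k : ℤ, p.2 = (k : ℚ))
    (d : ℤ) :
    ∃ D ∈ M,
      (∀ (k : ℤ) (u : V × ℚ), u ∈ M → D = k • u → k = 1 ∨ k = -1) ∧
      (∀ y ∈ M, ∃ k : ℤ, Φ' D y = ((2 * k : ℤ) : ℚ)) ∧
      (∃ y₀ ∈ M, Φ' D y₀ = 2) ∧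
      Φ' D D = ((8 * d - (2 * n - 2) : ℤ) : ℚ) := by
  have hfe : Φ f e = 1 := by rw [hsymm, hef]
  refine ⟨((2 : ℤ) • (e + d • f), 1), ?_, ?_, ?_, ⟨(f, 0), ?_, ?_⟩, ?_⟩
  · rw [hM]
    exact ⟨L.smul_mem _ (L.add_mem he (L.smul_mem _ hf)), 1, by simp⟩
  · intro k u hu hD
    obtain ⟨-, m, hm⟩ := (hM u).1 hu
    have hsnd : (1 : ℚ) = k • u.2 := congrArg Prod.snd hD
    rw [hm, zsmul_eq_mul] at hsnd
    exact Int.isUnit_iff.1 (IsUnit.of_mul_eq_one m (by exact_mod_cast hsnd.symm))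
  · intro y hy
    obtain ⟨hy₁, m, hm⟩ := (hM y).1 hy
    obtain ⟨a, ha⟩ := hint e he y.1 hy₁
    obtain ⟨b, hb⟩ := hint f hf y.1 hy₁
    refine ⟨a + d * b - (n - 1) * m, ?_⟩
    rw [hΦ']
    simp only [map_zsmul, map_add, LinearMap.smul_apply, LinearMap.add_apply, zsmul_eq_mul,
      ha, hb, hm]
    push_cast
    ring
  · rw [hM]
    exact ⟨hf, 0, by simp⟩
  · rw [hΦ']
    simp [hef, hff]
  · rw [hΦ']
    simp only [map_zsmul, map_add, LinearMap.smul_apply, LinearMap.add_apply, zsmul_eq_mul,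
      hee, hff, hef, hfe]
    push_cast
    ring
end

section
/- (Eichler's criterion, as used in the paper, without the orientation condition.) Let (V'', Φ'') be a finite-dimensional ℚ-vector space with a nondegenerate symmetric bilinear form and L'' ⊆ V'' a full even integral lattice. Let V = ℚ² × ℚ² × V'' with the symmetric bilinear form Φ which is the orthogonal direct sum of two hyperbolic planes ((x₁,x₂),(y₁,y₂)) ↦ x₁y₂ + x₂y₁ and Φ'', and let L = ℤ² × ℤ² × L''. Let v, w ∈ L be primitive elements such that Φ(v,v) = Φ(w,w) and such that (1/div(v))·v − (1/div(w))·w ∈ span_ℤ(L), where div(v), div(w) denote the divisibilities (i.e. [v/div(v)] = [w/div(w)] in the discriminant group A_L = L^∨/L). Then there exists a ℚ-linear automorphism g of V preserving Φ (an isometry), of determinant one, such that g maps L onto L, g(v) = w, and g acts trivially on A_L, i.e. g(y) − y ∈ span_ℤ(L) for every y ∈ L^∨. -/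
/-- The vector `y` lies in the dual of the `ℤ`-lattice `L` with respect to `Φ`. -/
def IsIntegralOn {V : Type*} [AddCommGroup V] [Module ℚ V] (Φ : V →ₗ[ℚ] V →ₗ[ℚ] ℚ)
    (L : Submodule ℤ V) (y : V) : Prop :=
  ∀ x ∈ L, ∃ k : ℤ, Φ y x = (k : ℚ)

namespace Eichler

variable {V : Type*} [AddCommGroup V] [Module ℚ V] {Φ : V →ₗ[ℚ] V →ₗ[ℚ] ℚ} {L : Submodule ℤ V}

/-- The dual of an integral lattice `L` is stable under translation by `L`. -/
theorem isIntegralOn_of_sub_mem (hint : ∀ x ∈ L, IsIntegralOn Φ L x) {y z : V}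
    (hy : IsIntegralOn Φ L y) (h : z - y ∈ L) : IsIntegralOn Φ L z := by
  intro x hx
  obtain ⟨k, hk⟩ := hy x hx
  obtain ⟨l, hl⟩ := hint _ h x hx
  refine ⟨l + k, ?_⟩
  rw [map_sub, LinearMap.sub_apply, hk] at hl
  push_cast
  linarith

/-- The group of isometries of determinant one acting trivially on the discriminant group of
an integral lattice. -/
def stableGroup (Φ : V →ₗ[ℚ] V →ₗ[ℚ] ℚ) (L : Submodule ℤ V)
    (hint : ∀ x ∈ L, IsIntegralOn Φ L x) : Subgroup (V ≃ₗ[ℚ] V) where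
  carrier := {g | (∀ x y, Φ (g x) (g y) = Φ x y) ∧ LinearEquiv.det g = 1 ∧
    ∀ y, IsIntegralOn Φ L y → g y - y ∈ L}
  one_mem' := ⟨fun _ _ => rfl, map_one _, fun y _ => by simp⟩
  mul_mem' := by
    rintro g h ⟨hg, hgd, hgL⟩ ⟨hh, hhd, hhL⟩
    refine ⟨fun x y => ?_, by rw [map_mul, hgd, hhd, one_mul], fun y hy => ?_⟩
    · rw [LinearEquiv.mul_apply, LinearEquiv.mul_apply, hg, hh]
    · have := L.add_mem (hgL _ (isIntegralOn_of_sub_mem hint hy (hhL y hy))) (hhL y hy)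
      rwa [sub_add_sub_cancel] at this
  inv_mem' := by
    rintro g ⟨hg, hgd, hgL⟩
    have hinv (x : V) : g (g⁻¹ x) = x := g.apply_symm_apply x
    refine ⟨fun x y => ?_, by rw [map_inv, hgd, inv_one], fun y hy => ?_⟩
    · rw [← hg, hinv, hinv]
    · have hz : IsIntegralOn Φ L (g⁻¹ y) := by
        intro x hx
        have hgx : g x ∈ L := by
          simpa using L.add_mem (hgL x (hint x hx)) hx
        rw [← hg, hinv]
        exact hy _ hgx
      have := L.neg_mem (hgL _ hz)
      rwa [hinv, neg_sub] at this

theorem apply_mem {hint : ∀ x ∈ L, IsIntegralOn Φ L x} {g : V ≃ₗ[ℚ] V}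
    (hg : g ∈ stableGroup Φ L hint) {x : V} (hx : x ∈ L) : g x ∈ L := by
  simpa using L.add_mem (hg.2.2 x (hint x hx)) hx

/-- The Eichler transvection attached to an isotropic vector `e ∈ L` and a vector `a ∈ L`
orthogonal to `e` lies in the stable group. -/
theorem exists_transvection (hsymm : ∀ x y, Φ x y = Φ y x)
    (hint : ∀ x ∈ L, IsIntegralOn Φ L x) (heven : ∀ x ∈ L, ∃ k : ℤ, Φ x x = 2 * (k : ℚ))
    {e a : V} (he : e ∈ L) (ha : a ∈ L) (hee : Φ e e = 0) (hea : Φ e a = 0) :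
    ∃ g ∈ stableGroup Φ L hint,
      ∀ x, g x = x - Φ a x • e + Φ e x • a - (2⁻¹ * Φ a a * Φ e x) • e := by
  have hae : Φ a e = 0 := by rw [hsymm, hea]
  have h₁ : Φ e (a + (2⁻¹ * Φ a a) • e) = 0 := by simp [hee, hea]
  have h₂ : Φ a (-e) = 0 := by simp [hae]
  have key (x : V) : (LinearEquiv.transvection h₂ * LinearEquiv.transvection h₁) x
      = x - Φ a x • e + Φ e x • a - (2⁻¹ * Φ a a * Φ e x) • e := by
    rw [LinearEquiv.mul_apply, LinearEquiv.transvection.apply, LinearEquiv.transvection.apply]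
    simp only [map_add, map_smul, smul_eq_mul, hae]
    module
  refine ⟨_, ⟨fun x y => ?_, ?_, fun y hy => ?_⟩, key⟩
  · rw [key, key]
    simp only [map_add, map_sub, map_smul, LinearMap.add_apply, LinearMap.sub_apply,
      LinearMap.smul_apply, smul_eq_mul, hee, hea, hae, hsymm x e, hsymm x a]
    ring
  · rw [map_mul, LinearEquiv.transvection.det_eq_one, LinearEquiv.transvection.det_eq_one, one_mul]
  · obtain ⟨m, hm⟩ := hy e he
    obtain ⟨n, hn⟩ := hy a ha
    obtain ⟨k, hk⟩ := heven a ha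
    have : (LinearEquiv.transvection h₂ * LinearEquiv.transvection h₁) y - y
        = m • a - n • e - (k * m) • e := by
      rw [key, hsymm a, hsymm e, hm, hn, hk]
      simp only [← Int.cast_smul_eq_zsmul ℚ]
      push_cast
      module
    rw [this]
    exact L.sub_mem (L.sub_mem (L.smul_mem _ ha) (L.smul_mem _ he)) (L.smul_mem _ he)

/-- Diagonalisation of integral `2 × 2` matrices by row and column operations: a property of
matrices with off-diagonal entries `A`, `-B` and diagonal entries `C`, `D` which is insensitive
to elementary operations and holds for diagonal matrices holds always. -/
theorem elementary_induction {P : ℤ → ℤ → ℤ → ℤ → Prop} (h0 : ∀ C D, P 0 0 C D)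
    (h₁ : ∀ k A B C D, P A (B - k * C) C (D + k * A) → P A B C D)
    (h₂ : ∀ k A B C D, P A (B - k * D) (C + k * A) D → P A B C D)
    (h₃ : ∀ k A B C D, P (A - k * C) B C (D + k * B) → P A B C D)
    (h₄ : ∀ k A B C D, P (A - k * D) B (C + k * B) D → P A B C D) (A B C D : ℤ) :
    P A B C D := by
  have hrotA (A B C D : ℤ) (h : P (-C) (-D) A B) : P A B C D := by
    apply h₂ 1
    apply h₃ 1
    apply h₂ 1
    convert h using 1 <;> ring
  have hrotB (A B C D : ℤ) (h : P (-D) (-C) B A) : P A B C D := by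
    apply h₄ 1
    apply h₁ 1
    apply h₄ 1
    convert h using 1 <;> ring
  have main (n : ℕ) : ∀ A B C D : ℤ, C ≠ 0 → C.natAbs = n → P A B C D := by
    induction n using Nat.strong_induction_on with
    | _ n ih =>
      intro A B C D hC hn
      have hlt (X : ℤ) : (X % C).natAbs < n := by
        rw [← hn]
        have h1 := Int.emod_nonneg X hC
        have h2 := Int.emod_lt_abs X hC
        zify
        rwa [abs_of_nonneg h1]
      apply h₃ (A / C)
      rw [show A - A / C * C = A % C by rw [Int.emod_def]; ring]
      by_cases hA : A % C = 0
      · rw [hA]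
        apply h₁ (B / C)
        rw [show B - B / C * C = B % C by rw [Int.emod_def]; ring]
        by_cases hB : B % C = 0
        · rw [hB]
          exact h0 _ _
        · exact hrotB _ _ _ _ (ih _ (hlt B) _ _ _ _ hB rfl)
      · exact hrotA _ _ _ _ (ih _ (hlt A) _ _ _ _ hA rfl)
  by_cases hC : C = 0
  · by_cases hA : A = 0
    · by_cases hB : B = 0
      · rw [hA, hB]
        exact h0 _ _
      · exact hrotB _ _ _ _ (main _ _ _ _ _ hB rfl)
    · exact hrotA _ _ _ _ (main _ _ _ _ _ hA rfl)
  · exact main _ _ _ _ _ hC rfl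

/-- If `L` contains two orthogonal hyperbolic planes, every vector of `L` can be moved by the
stable group into the orthogonal complement of the first plane. -/
theorem exists_orthogonal_hyperbolic (hsymm : ∀ x y, Φ x y = Φ y x)
    (hint : ∀ x ∈ L, IsIntegralOn Φ L x) (heven : ∀ x ∈ L, ∃ k : ℤ, Φ x x = 2 * (k : ℚ))
    {e f e' f' : V} (he : e ∈ L) (hf : f ∈ L) (he' : e' ∈ L) (hf' : f' ∈ L)
    (hee : Φ e e = 0) (hff : Φ f f = 0) (hef : Φ e f = 1)
    (hee' : Φ e' e' = 0) (hff' : Φ f' f' = 0) (hef' : Φ e' f' = 1)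
    (h1 : Φ e e' = 0) (h2 : Φ e f' = 0) (h3 : Φ f e' = 0) (h4 : Φ f f' = 0)
    {x : V} (hx : x ∈ L) :
    ∃ g ∈ stableGroup Φ L hint, Φ e (g x) = 0 ∧ Φ f (g x) = 0 := by
  have hfe : Φ f e = 1 := by rw [hsymm, hef]
  have hfe' : Φ f' e' = 1 := by rw [hsymm, hef']
  have h1' : Φ e' e = 0 := by rw [hsymm, h1]
  have h2' : Φ f' e = 0 := by rw [hsymm, h2]
  have h3' : Φ e' f = 0 := by rw [hsymm, h3]
  have h4' : Φ f' f = 0 := by rw [hsymm, h4]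
  let P : ℤ → ℤ → ℤ → ℤ → Prop := fun A B C D => ∀ x ∈ L,
    Φ e x = A → Φ f x = B → Φ e' x = C → Φ f' x = D →
    ∃ g ∈ stableGroup Φ L hint, Φ e (g x) = 0 ∧ Φ f (g x) = 0
  have step {A B C D A₁ B₁ C₁ D₁ : ℤ} {g : V ≃ₗ[ℚ] V} (hg : g ∈ stableGroup Φ L hint)
      (hP : P A₁ B₁ C₁ D₁) (h : ∀ x, Φ e x = A → Φ f x = B → Φ e' x = C → Φ f' x = D →
        Φ e (g x) = A₁ ∧ Φ f (g x) = B₁ ∧ Φ e' (g x) = C₁ ∧ Φ f' (g x) = D₁) : P A B C D := by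
    intro x hx hA hB hC hD
    obtain ⟨hA', hB', hC', hD'⟩ := h x hA hB hC hD
    obtain ⟨g', hg', h'⟩ := hP _ (apply_mem hg hx) hA' hB' hC' hD'
    exact ⟨g' * g, mul_mem hg' hg, h'⟩
  have all (A B C D : ℤ) : P A B C D := by
    refine elementary_induction (P := P) (fun C D x _ hA hB _ _ => ⟨1, one_mem _, ?_, ?_⟩)
      (fun k A B C D hP => ?_) (fun k A B C D hP => ?_) (fun k A B C D hP => ?_)
      (fun k A B C D hP => ?_) A B C D
    · simpa using hA
    · simpa using hB
    · obtain ⟨g, hg, hgx⟩ := exists_transvection hsymm hint heven he (L.smul_mem k he') hee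
        (by rw [← Int.cast_smul_eq_zsmul ℚ, map_smul, h1, smul_zero])
      refine step hg hP fun x hA hB hC hD => ?_
      rw [hgx, ← Int.cast_smul_eq_zsmul ℚ]
      simp [*, mul_comm]
    · obtain ⟨g, hg, hgx⟩ := exists_transvection hsymm hint heven he (L.smul_mem k hf') hee
        (by rw [← Int.cast_smul_eq_zsmul ℚ, map_smul, h2, smul_zero])
      refine step hg hP fun x hA hB hC hD => ?_
      rw [hgx, ← Int.cast_smul_eq_zsmul ℚ]
      simp [*, mul_comm]
    · obtain ⟨g, hg, hgx⟩ := exists_transvection hsymm hint heven hf (L.smul_mem k he') hff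
        (by rw [← Int.cast_smul_eq_zsmul ℚ, map_smul, h3, smul_zero])
      refine step hg hP fun x hA hB hC hD => ?_
      rw [hgx, ← Int.cast_smul_eq_zsmul ℚ]
      simp [*, mul_comm]
    · obtain ⟨g, hg, hgx⟩ := exists_transvection hsymm hint heven hf (L.smul_mem k hf') hff
        (by rw [← Int.cast_smul_eq_zsmul ℚ, map_smul, h4, smul_zero])
      refine step hg hP fun x hA hB hC hD => ?_
      rw [hgx, ← Int.cast_smul_eq_zsmul ℚ]
      simp [*, mul_comm]
  obtain ⟨A, hA⟩ := hint e he x hx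
  obtain ⟨B, hB⟩ := hint f hf x hx
  obtain ⟨C, hC⟩ := hint e' he' x hx
  obtain ⟨D, hD⟩ := hint f' hf' x hx
  exact all A B C D x hx hA hB hC hD

/-- Two vectors orthogonal to a hyperbolic plane of `L`, of the same norm, pairing to `d` with
some vectors of `L`, and congruent modulo `d • L` are equivalent under the stable group. -/
theorem exists_apply_eq_of_orthogonal (hsymm : ∀ x y, Φ x y = Φ y x)
    (hint : ∀ x ∈ L, IsIntegralOn Φ L x) (heven : ∀ x ∈ L, ∃ k : ℤ, Φ x x = 2 * (k : ℚ))
    {e f : V} (he : e ∈ L) (hf : f ∈ L)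
    (hee : Φ e e = 0) (hff : Φ f f = 0) (hef : Φ e f = 1)
    {u v : V} (heu : Φ e u = 0) (hfu : Φ f u = 0) (hev : Φ e v = 0) (hfv : Φ f v = 0)
    (hsq : Φ u u = Φ v v) {d : ℚ} (hd : d ≠ 0) (hud : ∃ x ∈ L, Φ u x = d)
    (hvd : ∃ x ∈ L, Φ v x = d) (huv : d⁻¹ • u - d⁻¹ • v ∈ L) :
    ∃ g ∈ stableGroup Φ L hint, g u = v := by
  have hfe : Φ f e = 1 := by rw [hsymm, hef]
  have shift {u : V} (heu : Φ e u = 0) (hfu : Φ f u = 0) (hud : ∃ x ∈ L, Φ u x = d) :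
      ∃ g ∈ stableGroup Φ L hint, g u = u - d • e := by
    obtain ⟨x, hx, hxd⟩ := hud
    obtain ⟨m, hm⟩ := hint e he x hx
    obtain ⟨g, hg, hgx⟩ := exists_transvection hsymm hint heven he
      (a := x - m • f) (L.sub_mem hx (L.smul_mem m hf)) hee
      (by simp [← Int.cast_smul_eq_zsmul ℚ, hm, hef])
    refine ⟨g, hg, ?_⟩
    have : Φ (x - m • f) u = d := by
      simp [← Int.cast_smul_eq_zsmul ℚ, hsymm x u, hxd, hfu]
    rw [hgx, this, heu]
    module
  obtain ⟨g₁, hg₁, hgu⟩ := shift heu hfu hud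
  obtain ⟨g₂, hg₂, hgv⟩ := shift hev hfv hvd
  obtain ⟨g₃, hg₃, hgw⟩ := exists_transvection hsymm hint heven hf huv hff
    (by simp [hfu, hfv])
  refine ⟨g₂⁻¹ * g₃ * g₁, mul_mem (mul_mem (inv_mem hg₂) hg₃) hg₁, ?_⟩
  have : g₃ (g₁ u) = g₂ v := by
    rw [hgu, hgv, hgw]
    simp only [map_sub, map_smul, LinearMap.sub_apply, LinearMap.smul_apply, smul_eq_mul, hfu,
      hfe, hsymm u e, hsymm v e, heu, hev, hsymm v u, hsq]
    match_scalars <;> field_simp <;> ring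
  rw [LinearEquiv.mul_apply, LinearEquiv.mul_apply, this]
  exact g₂.symm_apply_apply v

/-- If `w` is primitive and `v / m - w / n` lies in `L`, then `n` divides `m`. -/
theorem dvd_of_primitive {v w : V} (hv : v ∈ L) (hw : w ∈ L)
    (hprim : ∀ (k : ℤ) (u : V), u ∈ L → w = k • u → k = 1 ∨ k = -1)
    {m n : ℤ} (hm : m ≠ 0) (hn : n ≠ 0) (h : (m : ℚ)⁻¹ • v - (n : ℚ)⁻¹ • w ∈ L) : n ∣ m := by
  have hm' : (m : ℚ) ≠ 0 := by exact_mod_cast hm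
  have hn' : (n : ℚ) ≠ 0 := by exact_mod_cast hn
  obtain ⟨k, hk⟩ := Int.gcd_dvd_right m n
  have hbez : ((Int.gcd m n : ℤ) : ℚ) = m * m.gcdA n + n * m.gcdB n := by
    exact_mod_cast Int.gcd_eq_gcd_ab m n
  have hk' : (n : ℚ) = (Int.gcd m n : ℤ) * k := by exact_mod_cast hk
  have key : w = k • (m.gcdA n • (v - m • ((m : ℚ)⁻¹ • v - (n : ℚ)⁻¹ • w)) + m.gcdB n • w) := by
    simp only [← Int.cast_smul_eq_zsmul ℚ]
    match_scalars
    · field_simp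
      linear_combination hk' + k * hbez
    · field_simp
      ring
  have hu := L.add_mem
    (L.smul_mem (m.gcdA n) (L.sub_mem hv (L.smul_mem m h))) (L.smul_mem (m.gcdB n) hw)
  have hdvd := Int.gcd_dvd_left m n
  rcases hprim k _ hu key with rfl | rfl
  · rwa [hk, mul_one]
  · rw [hk, mul_neg_one]
    exact neg_dvd.2 hdvd

end Eichler

/-- **Eichler's criterion** (as used in the paper, without the orientation condition).
Let `(V'', Φ'')` be a finite-dimensional `ℚ`-vector space with a nondegenerate symmetric
bilinear form and `L'' ⊆ V''` a full even integral lattice.  Let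
`V = ℚ² × ℚ² × V''` with the form `Φ` which is the orthogonal direct sum of two
hyperbolic planes and `Φ''`, and let `L = ℤ² × ℤ² × L''` (i.e. `L = U ⊕ U ⊕ L''`).
Let `v, w ∈ L` be primitive with `Φ(v,v) = Φ(w,w)` and with
`v/div(v) - w/div(w) ∈ L` (i.e. `[v/div v] = [w/div w]` in `A_L = L^∨/L`).  Then
there is an isometry `g` of `(V, Φ)` of determinant one mapping `L` onto `L`, with
`g(v) = w`, acting trivially on `A_L` (i.e. `g(y) - y ∈ L` for every `y ∈ L^∨`). -/
theorem eichler_criterion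
    {V'' : Type*} [AddCommGroup V''] [Module ℚ V''] [FiniteDimensional ℚ V'']
    (Φ'' : V'' →ₗ[ℚ] V'' →ₗ[ℚ] ℚ)
    (hsymm'' : ∀ x y : V'', Φ'' x y = Φ'' y x)
    (hnd'' : ∀ v : V'', (∀ u : V'', Φ'' v u = 0) → v = 0)
    (L'' : Submodule ℤ V'') (hfg'' : L''.FG)
    (hfull'' : Submodule.span ℚ (L'' : Set V'') = ⊤)
    (hint'' : ∀ x ∈ L'', ∀ y ∈ L'', ∃ k : ℤ, Φ'' x y = (k : ℚ))
    (heven'' : ∀ x ∈ L'', ∃ k : ℤ, Φ'' x x = ((2 * k : ℤ) : ℚ))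
    (Φ : ((ℚ × ℚ) × (ℚ × ℚ) × V'') →ₗ[ℚ] ((ℚ × ℚ) × (ℚ × ℚ) × V'') →ₗ[ℚ] ℚ)
    (hΦ : ∀ p q : (ℚ × ℚ) × (ℚ × ℚ) × V'',
      Φ p q = (p.1.1 * q.1.2 + p.1.2 * q.1.1) + (p.2.1.1 * q.2.1.2 + p.2.1.2 * q.2.1.1)
        + Φ'' p.2.2 q.2.2)
    (L : Submodule ℤ ((ℚ × ℚ) × (ℚ × ℚ) × V''))
    (hL : ∀ p : (ℚ × ℚ) × (ℚ × ℚ) × V'',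
      p ∈ L ↔ (∃ a b : ℤ, p.1 = ((a : ℚ), (b : ℚ))) ∧
        (∃ a b : ℤ, p.2.1 = ((a : ℚ), (b : ℚ))) ∧ p.2.2 ∈ L'')
    (v w : (ℚ × ℚ) × (ℚ × ℚ) × V'') (hv : v ∈ L) (hw : w ∈ L)
    (hvprim : ∀ (k : ℤ) (u : (ℚ × ℚ) × (ℚ × ℚ) × V''), u ∈ L → v = k • u → k = 1 ∨ k = -1)
    (hwprim : ∀ (k : ℤ) (u : (ℚ × ℚ) × (ℚ × ℚ) × V''), u ∈ L → w = k • u → k = 1 ∨ k = -1)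
    (hsq : Φ v v = Φ w w)
    (dv dw : ℤ) (hdvpos : 0 < dv) (hdwpos : 0 < dw)
    (hdvdvd : ∀ x ∈ L, ∃ k : ℤ, Φ v x = ((dv * k : ℤ) : ℚ))
    (hdvmem : ∃ x ∈ L, Φ v x = (dv : ℚ))
    (hdwdvd : ∀ x ∈ L, ∃ k : ℤ, Φ w x = ((dw * k : ℤ) : ℚ))
    (hdwmem : ∃ x ∈ L, Φ w x = (dw : ℚ))
    (hdisc : (dv : ℚ)⁻¹ • v - (dw : ℚ)⁻¹ • w ∈ L) :
    ∃ g : ((ℚ × ℚ) × (ℚ × ℚ) × V'') ≃ₗ[ℚ] ((ℚ × ℚ) × (ℚ × ℚ) × V''),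
      (∀ x y, Φ (g x) (g y) = Φ x y) ∧
      LinearMap.det (g.toLinearMap) = 1 ∧
      (∀ x ∈ L, g x ∈ L) ∧ (∀ x ∈ L, g.symm x ∈ L) ∧
      g v = w ∧
      (∀ y : (ℚ × ℚ) × (ℚ × ℚ) × V'',
        (∀ x ∈ L, ∃ k : ℤ, Φ y x = (k : ℚ)) → g y - y ∈ L) := by
  have hsymm (x y) : Φ x y = Φ y x := by
    rw [hΦ, hΦ, hsymm'' x.2.2]
    ring
  have hint (x) (hx : x ∈ L) : IsIntegralOn Φ L x := by
    intro y hy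
    obtain ⟨⟨a, b, h1⟩, ⟨c, d, h2⟩, h3⟩ := (hL x).1 hx
    obtain ⟨⟨a', b', h1'⟩, ⟨c', d', h2'⟩, h3'⟩ := (hL y).1 hy
    obtain ⟨k, hk⟩ := hint'' _ h3 _ h3'
    refine ⟨(a * b' + b * a') + (c * d' + d * c') + k, ?_⟩
    rw [hΦ, h1, h2, h1', h2', hk]
    push_cast
    ring
  have heven (x) (hx : x ∈ L) : ∃ k : ℤ, Φ x x = 2 * (k : ℚ) := by
    obtain ⟨⟨a, b, h1⟩, ⟨c, d, h2⟩, h3⟩ := (hL x).1 hx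
    obtain ⟨k, hk⟩ := heven'' _ h3
    refine ⟨a * b + c * d + k, ?_⟩
    rw [hΦ, h1, h2, hk]
    push_cast
    ring
  have mem (a b c d : ℤ) : (((a : ℚ), (b : ℚ)), ((c : ℚ), (d : ℚ)), (0 : V'')) ∈ L :=
    (hL _).2 ⟨⟨a, b, rfl⟩, ⟨c, d, rfl⟩, L''.zero_mem⟩
  have he := mem 1 0 0 0
  have hf := mem 0 1 0 0
  have he' := mem 0 0 1 0
  have hf' := mem 0 0 0 1
  have move {x} (hx : x ∈ L) := Eichler.exists_orthogonal_hyperbolic hsymm hint heven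
    he hf he' hf' (by simp [hΦ]) (by simp [hΦ]) (by simp [hΦ]) (by simp [hΦ]) (by simp [hΦ])
    (by simp [hΦ]) (by simp [hΦ]) (by simp [hΦ]) (by simp [hΦ]) (by simp [hΦ]) hx
  have hd : dv = dw := by
    refine Int.dvd_antisymm hdvpos.le hdwpos.le ?_ ?_
    · refine Eichler.dvd_of_primitive hw hv hvprim hdwpos.ne' hdvpos.ne' ?_
      simpa using L.neg_mem hdisc
    · exact Eichler.dvd_of_primitive hv hw hwprim hdvpos.ne' hdwpos.ne' hdisc
  subst hd
  have hd0 : (dv : ℚ) ≠ 0 := by exact_mod_cast hdvpos.ne'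
  have dual {x} (hx : ∀ y ∈ L, ∃ k : ℤ, Φ x y = ((dv * k : ℤ) : ℚ)) :
      IsIntegralOn Φ L ((dv : ℚ)⁻¹ • x) := by
    intro y hy
    obtain ⟨k, hk⟩ := hx y hy
    refine ⟨k, ?_⟩
    rw [map_smul, LinearMap.smul_apply, hk, smul_eq_mul]
    push_cast
    field_simp
  obtain ⟨g, hg, hge, hgf⟩ := move hv
  obtain ⟨h, hh, hhe, hhf⟩ := move hw
  have hgd := hg.2.2 _ (dual hdvdvd)
  have hhd := hh.2.2 _ (dual hdwdvd)
  have hdisc' : (dv : ℚ)⁻¹ • g v - (dv : ℚ)⁻¹ • h w ∈ L := by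
    have := L.sub_mem (L.add_mem hgd hdisc) hhd
    rw [map_smul, map_smul] at this
    convert this using 1
    abel
  obtain ⟨t, ht, htv⟩ := Eichler.exists_apply_eq_of_orthogonal hsymm hint heven he hf
    (by simp [hΦ]) (by simp [hΦ]) (by simp [hΦ]) hge hgf hhe hhf
    (by rw [hg.1, hh.1, hsq]) hd0
    (by
      obtain ⟨x, hx, hxd⟩ := hdvmem
      exact ⟨g x, Eichler.apply_mem hg hx, by rw [hg.1, hxd]⟩)
    (by
      obtain ⟨x, hx, hxd⟩ := hdwmem
      exact ⟨h x, Eichler.apply_mem hh hx, by rw [hh.1, hxd]⟩) hdisc'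
  have hG := mul_mem (mul_mem (inv_mem hh) ht) hg
  refine ⟨h⁻¹ * t * g, hG.1, ?_, fun x hx => Eichler.apply_mem hG hx,
    fun x hx => Eichler.apply_mem (inv_mem hG) hx, ?_, hG.2.2⟩
  · have := congrArg Units.val hG.2.1
    rwa [LinearEquiv.coe_det] at this
  · rw [LinearEquiv.mul_apply, LinearEquiv.mul_apply, htv]
    exact h.symm_apply_apply w
end

section
/- Let (V, Φ) be a finite-dimensional ℚ-vector space with a nondegenerate symmetric bilinear form and M ⊆ V a full integral lattice. Let W ⊆ V be a subspace on which Φ restricts to a nondegenerate form, and let L = M ∩ W (the primitively embedded sublattice of M with ambient space W). Let g : W → W be a ℚ-linear isometry of Φ|_W mapping L onto L and acting trivially on the discriminant group of L in W, i.e. g(y) − y ∈ span_ℤ(L) for every y ∈ W with Φ(y, x) ∈ ℤ for all x ∈ L. Then the ℚ-linear map G : V → V which equals g on W and the identity on the orthogonal complement W^⊥ is an isometry of (V, Φ) mapping M onto M (and restricting to the identity on W^⊥). -/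
/-- A subspace on which a bilinear form is nondegenerate has an orthogonal complement:
every vector is the sum of a vector of the subspace and one orthogonal to it. -/
lemma exists_mem_add_orthogonal {K V : Type*} [Field K] [AddCommGroup V] [Module K V]
    [FiniteDimensional K V] (Φ : V →ₗ[K] V →ₗ[K] K) (W : Submodule K V)
    (hW : ∀ v ∈ W, (∀ u ∈ W, Φ v u = 0) → v = 0) (v : V) :
    ∃ w ∈ W, ∃ p : V, (∀ x ∈ W, Φ p x = 0) ∧ v = w + p := by
  let f : W →ₗ[K] Module.Dual K W := Φ.domRestrict₁₂ W W
  have hf : Function.Injective f := by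
    rw [injective_iff_map_eq_zero]
    intro w hw
    exact Subtype.ext (hW w w.2 fun u hu => LinearMap.congr_fun hw ⟨u, hu⟩)
  have hf' : Function.Surjective f :=
    (LinearMap.injective_iff_surjective_of_finrank_eq_finrank
      Subspace.dual_finrank_eq.symm).1 hf
  obtain ⟨w, hw⟩ := hf' ((Φ v).domRestrict W)
  refine ⟨w, w.2, v - w, fun x hx => ?_, by abel⟩
  have h : Φ w x = Φ v x := LinearMap.congr_fun hw ⟨x, hx⟩
  rw [map_sub, LinearMap.sub_apply, h, sub_self]

/-- **Extension of an isometry acting trivially on the discriminant group.**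
Let `(V, Φ)` be a finite-dimensional `ℚ`-vector space with a nondegenerate symmetric
bilinear form and `M ⊆ V` a full integral lattice.  Let `W ⊆ V` be a subspace on which
`Φ` is nondegenerate, and `L = M ∩ W`.  Let `g` be a `ℚ`-linear isometry of `(W, Φ|_W)`
mapping `L` onto `L` and acting trivially on the discriminant group of `L` in `W`
(i.e. `g(y) - y ∈ L` for every `y ∈ W` pairing integrally with `L`).  Then the
`ℚ`-linear map `G : V → V` equal to `g` on `W` and to the identity on `W^⊥` is an
isometry of `(V, Φ)` mapping `M` onto `M`. -/
theorem isometry_extension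
    {V : Type*} [AddCommGroup V] [Module ℚ V] [FiniteDimensional ℚ V]
    (Φ : V →ₗ[ℚ] V →ₗ[ℚ] ℚ)
    (hsymm : ∀ x y : V, Φ x y = Φ y x)
    (hnd : ∀ v : V, (∀ u : V, Φ v u = 0) → v = 0)
    (M : Submodule ℤ V) (hMfg : M.FG)
    (hMfull : Submodule.span ℚ (M : Set V) = ⊤)
    (hMint : ∀ x ∈ M, ∀ y ∈ M, ∃ k : ℤ, Φ x y = (k : ℚ))
    (W : Submodule ℚ V)
    (hWnd : ∀ v ∈ W, (∀ u ∈ W, Φ v u = 0) → v = 0)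
    (L : Submodule ℤ V)
    (hL : ∀ x : V, x ∈ L ↔ x ∈ M ∧ x ∈ W)
    (g : V →ₗ[ℚ] V)
    (hgW : ∀ x ∈ W, g x ∈ W)
    (hgiso : ∀ x ∈ W, ∀ y ∈ W, Φ (g x) (g y) = Φ x y)
    (hgL : ∀ x ∈ L, g x ∈ L)
    (hgLonto : ∀ x ∈ L, ∃ y ∈ L, g y = x)
    (hgdisc : ∀ y ∈ W, (∀ x ∈ L, ∃ k : ℤ, Φ y x = (k : ℚ)) → g y - y ∈ L)
    (G : V →ₗ[ℚ] V)
    (hGW : ∀ x ∈ W, G x = g x)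
    (hGperp : ∀ v : V, (∀ x ∈ W, Φ v x = 0) → G v = v) :
    (∀ x y : V, Φ (G x) (G y) = Φ x y) ∧
    Function.Bijective G ∧
    (∀ x ∈ M, G x ∈ M) ∧ (∀ x ∈ M, ∃ y ∈ M, G y = x) := by
  have hdec := exists_mem_add_orthogonal Φ W hWnd
  have hG : ∀ w ∈ W, ∀ p : V, (∀ x ∈ W, Φ p x = 0) → G (w + p) = g w + p := by
    intro w hw p hp
    rw [map_add, hGW w hw, hGperp p hp]
  have hiso : ∀ x y : V, Φ (G x) (G y) = Φ x y := by
    intro x y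
    obtain ⟨w, hw, p, hp, rfl⟩ := hdec x
    obtain ⟨w', hw', p', hp', rfl⟩ := hdec y
    rw [hG w hw p hp, hG w' hw' p' hp']
    simp only [map_add, LinearMap.add_apply]
    rw [hgiso w hw w' hw', hp _ (hgW w' hw'), hp w' hw', hsymm (g w) p', hsymm w p',
      hp' _ (hgW w hw), hp' w hw]
  have hinj : Function.Injective G := by
    rw [injective_iff_map_eq_zero]
    intro v hv
    refine hnd v fun u => ?_
    rw [← hiso v u, hv, map_zero, LinearMap.zero_apply]
  have hsurj : Function.Surjective G := LinearMap.injective_iff_surjective.1 hinj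
  refine ⟨hiso, ⟨hinj, hsurj⟩, fun x hx => ?_, fun x hx => ?_⟩
  · obtain ⟨w, hw, p, hp, rfl⟩ := hdec x
    have hd : g w - w ∈ L := by
      refine hgdisc w hw fun l hl => ?_
      obtain ⟨hlM, hlW⟩ := (hL l).1 hl
      simpa [hp l hlW] using hMint _ hx l hlM
    rw [hG w hw p hp, show g w + p = (w + p) + (g w - w) by abel]
    exact M.add_mem hx ((hL _).1 hd).1
  · obtain ⟨y, rfl⟩ := hsurj x
    refine ⟨y, ?_, rfl⟩
    obtain ⟨w, hw, p, hp, rfl⟩ := hdec y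
    rw [hG w hw p hp] at hx
    have hd : g w - w ∈ L := by
      refine hgdisc w hw fun l hl => ?_
      obtain ⟨hlM, hlW⟩ := (hL _).1 (hgL l hl)
      have h := hMint _ hx _ hlM
      rwa [map_add, LinearMap.add_apply, hp _ hlW, add_zero,
        hgiso w hw l ((hL l).1 hl).2] at h
    rw [show w + p = (g w + p) - (g w - w) by abel]
    exact M.sub_mem hx ((hL _).1 hd).1
end
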